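/- Phragmén–Lindelöf principle for strip domains: Let f be a slice regular function on a strip domain Ω of width γ, continuous up to the boundary. Suppose that |f(q)| ≤ N exp(e^{k|q|}) for all q ∈ Ω, for some positive constants N and k with k < π/γ. If there exists M ≥ 0 such that |f(q)| ≤ M for all q ∈ ∂Ω, then |f(q)| ≤ M for all q ∈ Ω. -/

import Mathlib

open scoped Quaternion

/-- The sphere of imaginary units in the quaternions. -/
def qSphere : Set ℍ[ℝ] := {q : ℍ[ℝ] | q.re = 0 ∧ ‖q‖ = 1}

/-- The point of the slice `L_I = ℝ + ℝI` corresponding to `z = x + iy ∈ ℂ`. -/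
noncomputable def toSlice (I : ℍ[ℝ]) (z : ℂ) : ℍ[ℝ] := (z.re : ℍ[ℝ]) + z.im • I

/-- `f` is slice regular on `Ω`: for each imaginary unit `I`, the restriction of `f` to
`Ω ∩ L_I`, read through the parametrization `toSlice I : ℂ → L_I`, is real differentiable
and satisfies the Cauchy–Riemann equation `∂f/∂x + I ∂f/∂y = 0`. -/
def SliceRegularOn (f : ℍ[ℝ] → ℍ[ℝ]) (Ω : Set ℍ[ℝ]) : Prop :=
  ∀ I ∈ qSphere, ∀ z : ℂ, toSlice I z ∈ Ω →
    ∃ D : ℂ →L[ℝ] ℍ[ℝ],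
      HasFDerivWithinAt (fun w => f (toSlice I w)) D (toSlice I ⁻¹' Ω) z ∧
      D 1 + I * D Complex.I = 0

/-- A slice domain: a domain meeting the real axis all of whose slices are domains. -/
def IsSliceDomain (Ω : Set ℍ[ℝ]) : Prop :=
  IsOpen Ω ∧ IsConnected Ω ∧ (∃ x : ℝ, (x : ℍ[ℝ]) ∈ Ω) ∧
  ∀ I ∈ qSphere, IsConnected (toSlice I ⁻¹' Ω)

/-- `cos θ + I sin θ`. -/
noncomputable def expI (I : ℍ[ℝ]) (θ : ℝ) : ℍ[ℝ] := (Real.cos θ : ℍ[ℝ]) + Real.sin θ • I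

/-- The circular cone of opening `φ` around the positive real axis. -/
def circularCone (φ : ℝ) : Set ℍ[ℝ] :=
  {q : ℍ[ℝ] | ∃ r θ : ℝ, ∃ I ∈ qSphere, 0 < r ∧ |θ| < φ / 2 ∧ q = r • expI I θ}

/-- `M_f(r)`: the maximum of `‖f‖` on the closure of `Ω` intersected with the sphere of radius `r`. -/
noncomputable def maxMod (f : ℍ[ℝ] → ℍ[ℝ]) (Ω : Set ℍ[ℝ]) (r : ℝ) : ℝ :=
  sSup ((fun q => ‖f q‖) '' (closure Ω ∩ Metric.sphere (0 : ℍ[ℝ]) r))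

/-- The order of a slice regular function. -/
noncomputable def growthOrder (f : ℍ[ℝ] → ℍ[ℝ]) (Ω : Set ℍ[ℝ]) : EReal :=
  Filter.limsup (fun r : ℝ =>
    ((max 0 (Real.log (max 0 (Real.log (maxMod f Ω r)))) / Real.log r : ℝ) : EReal))
    Filter.atTop

/-- The type of a slice regular function of order `ρ`. -/
noncomputable def growthType (f : ℍ[ℝ] → ℍ[ℝ]) (Ω : Set ℍ[ℝ]) (ρ : ℝ) : EReal :=
  Filter.limsup (fun r : ℝ => ((max 0 (Real.log (maxMod f Ω r)) / r ^ ρ : ℝ) : EReal))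
    Filter.atTop

/-- The angle of opening `φ` bisected by the half line of argument `ζ` in the slice `L_I`. -/
def angleSet (I : ℍ[ℝ]) (ζ φ : ℝ) : Set ℍ[ℝ] :=
  {q : ℍ[ℝ] | ∃ r θ : ℝ, 0 < r ∧ |θ| < φ / 2 ∧ q = r • expI I (ζ + θ)}

/-- The real affine line through `p` with direction `d`. -/
def lineSet (p d : ℍ[ℝ]) : Set ℍ[ℝ] := {q : ℍ[ℝ] | ∃ t : ℝ, q = p + t • d}

/-- `f` is slice preserving: it maps each slice into itself. -/
def SlicePreservingOn (f : ℍ[ℝ] → ℍ[ℝ]) (Ω : Set ℍ[ℝ]) : Prop :=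
  ∀ I ∈ qSphere, ∀ q ∈ Ω ∩ Set.range (toSlice I), f q ∈ Set.range (toSlice I)

/-- The principal quaternionic logarithm. -/
noncomputable def QLog (q : ℍ[ℝ]) : ℍ[ℝ] :=
  (Real.log ‖q‖ : ℍ[ℝ]) + Real.arccos (q.re / ‖q‖) • (‖q.im‖⁻¹ • q.im)

open Set Filter Topology

lemma mul_self_of_mem_qSphere {I : ℍ[ℝ]} (hI : I ∈ qSphere) : I * I = -1 := by
  obtain ⟨hre, hnorm⟩ := hI
  have hstar : star I = -I := Quaternion.star_eq_neg.2 hre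
  have h := Quaternion.self_mul_star I
  rw [hstar, Quaternion.normSq_eq_norm_mul_self, hnorm] at h
  rw [mul_neg] at h
  rw [← neg_neg (I * I), h]
  simp

lemma toSlice_one (I : ℍ[ℝ]) : toSlice I 1 = 1 := by simp [toSlice]

lemma toSlice_zero (I : ℍ[ℝ]) : toSlice I 0 = 0 := by simp [toSlice]

lemma toSlice_ofReal (I : ℍ[ℝ]) (x : ℝ) : toSlice I x = x := by simp [toSlice]

lemma toSlice_add (I : ℍ[ℝ]) (z w : ℂ) : toSlice I (z + w) = toSlice I z + toSlice I w := by
  simp [toSlice, add_smul]; abel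

lemma toSlice_sub (I : ℍ[ℝ]) (z w : ℂ) : toSlice I (z - w) = toSlice I z - toSlice I w := by
  rw [eq_sub_iff_add_eq, ← toSlice_add, sub_add_cancel]

lemma toSlice_mul {I : ℍ[ℝ]} (hI : I ∈ qSphere) (z w : ℂ) :
    toSlice I (z * w) = toSlice I z * toSlice I w := by
  have hcomm (x y : ℝ) : (x : ℍ[ℝ]) * y = ((x * y : ℝ) : ℍ[ℝ]) := (Quaternion.coe_mul x y).symm
  simp only [toSlice, Complex.mul_re, Complex.mul_im, Quaternion.coe_sub, add_mul, mul_add,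
    smul_mul_assoc, mul_smul_comm, mul_self_of_mem_qSphere hI, hcomm, Quaternion.coe_mul_eq_smul,
    Quaternion.mul_coe_eq_smul, add_smul, smul_add, smul_neg, smul_smul]
  rw [← mul_one ((z.im * w.im : ℝ) : ℍ[ℝ]), Quaternion.coe_mul_eq_smul, mul_comm w.im z.im,
    mul_comm w.im z.re]
  abel

lemma norm_toSlice {I : ℍ[ℝ]} (hI : I ∈ qSphere) (z : ℂ) : ‖toSlice I z‖ = ‖z‖ := by
  obtain ⟨hre, hnorm⟩ := hI
  have hI' : I.imI ^ 2 + I.imJ ^ 2 + I.imK ^ 2 = 1 := by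
    have h := Quaternion.normSq_eq_norm_mul_self I
    rw [Quaternion.normSq_def', hnorm, hre] at h
    linarith
  rw [← sq_eq_sq₀ (norm_nonneg _) (norm_nonneg _), sq, ← Quaternion.normSq_eq_norm_mul_self,
    Quaternion.normSq_def', Complex.sq_norm, Complex.normSq_apply]
  simp [toSlice, hre]
  linear_combination z.im ^ 2 * hI'

lemma isometry_toSlice {I : ℍ[ℝ]} (hI : I ∈ qSphere) : Isometry (toSlice I) :=
  Isometry.of_dist_eq fun z w => by
    rw [dist_eq_norm, ← toSlice_sub, norm_toSlice hI, dist_eq_norm]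

lemma exists_mem_range_toSlice (q : ℍ[ℝ]) : ∃ I ∈ qSphere, q ∈ range (toSlice I) := by
  have hq : (q.re : ℍ[ℝ]) + q.im = q := Quaternion.re_add_im q
  by_cases h : q.im = 0
  · refine ⟨Complex.I, ⟨by simp, ?_⟩, q.re, ?_⟩
    · rw [← sq_eq_sq₀ (norm_nonneg _) zero_le_one, sq, ← Quaternion.normSq_eq_norm_mul_self,
        Quaternion.normSq_def']
      simp
    · rw [toSlice_ofReal]
      simpa [h] using hq
  · refine ⟨‖q.im‖⁻¹ • q.im, ⟨by simp, by simp [norm_smul, h]⟩, ⟨q.re, ‖q.im‖⟩, ?_⟩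
    rw [toSlice, smul_smul, mul_inv_cancel₀ (norm_ne_zero_iff.2 h), one_smul]
    exact hq

/-- The complex normed space structure on the quaternions in which the imaginary unit acts
as left multiplication by `I`. -/
noncomputable abbrev sliceNormedSpace {I : ℍ[ℝ]} (hI : I ∈ qSphere) : NormedSpace ℂ ℍ[ℝ] where
  smul z q := toSlice I z * q
  one_smul q := by change toSlice I 1 * q = q; rw [toSlice_one, one_mul]
  mul_smul z w q := by
    change toSlice I (z * w) * q = toSlice I z * (toSlice I w * q)
    rw [toSlice_mul hI, mul_assoc]
  smul_zero z := mul_zero (toSlice I z)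
  smul_add z q r := mul_add (toSlice I z) q r
  add_smul z w q := by
    change toSlice I (z + w) * q = toSlice I z * q + toSlice I w * q
    rw [toSlice_add, add_mul]
  zero_smul q := by change toSlice I 0 * q = 0; rw [toSlice_zero, zero_mul]
  norm_smul_le z q := by
    change ‖toSlice I z * q‖ ≤ ‖z‖ * ‖q‖
    rw [norm_mul, norm_toSlice hI]

lemma SliceRegularOn.differentiableAt {f : ℍ[ℝ] → ℍ[ℝ]} {Ω : Set ℍ[ℝ]} (hf : SliceRegularOn f Ω)
    (hΩ : IsOpen Ω) {I : ℍ[ℝ]} (hI : I ∈ qSphere) {z : ℂ} (hz : toSlice I z ∈ Ω) :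
    let := sliceNormedSpace hI
    DifferentiableAt ℂ (fun w => f (toSlice I w)) z := by
  let := sliceNormedSpace hI
  have hsmul (z : ℂ) (q : ℍ[ℝ]) : z • q = toSlice I z * q := rfl
  have : IsScalarTower ℝ ℂ ℍ[ℝ] := ⟨fun x z q => by
    rw [hsmul, hsmul, Complex.real_smul, toSlice_mul hI, toSlice_ofReal, mul_assoc,
      Quaternion.coe_mul_eq_smul]⟩
  obtain ⟨D, hD, hCR⟩ := hf I hI z hz
  replace hD := hD.hasFDerivAt ((hΩ.preimage (isometry_toSlice hI).continuous).mem_nhds hz)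
  have hDI : D Complex.I = I * D 1 := by
    have h := congrArg (I * ·) hCR
    simp only [mul_add, ← mul_assoc, mul_self_of_mem_qSphere hI, mul_zero, neg_one_mul] at h
    exact (add_neg_eq_zero.1 h).symm
  refine (hasFDerivAt_of_restrictScalars ℝ hD
    (f' := ContinuousLinearMap.toSpanSingleton ℂ (D 1)) ?_).differentiableAt
  refine ContinuousLinearMap.ext fun z => ?_
  have hD_apply : D z = z.re • D 1 + z.im • D Complex.I := by
    rw [← map_smul, ← map_smul, ← map_add]
    congr 1
    simp
  simp only [ContinuousLinearMap.coe_restrictScalars', ContinuousLinearMap.toSpanSingleton_apply]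
  rw [hD_apply, hDI, hsmul, toSlice, add_mul, Quaternion.coe_mul_eq_smul, smul_mul_assoc]

lemma infDist_range_ofReal (z : ℂ) : Metric.infDist z (range ((↑) : ℝ → ℂ)) = |z.im| := by
  refine le_antisymm ?_ ?_
  · refine (Metric.infDist_le_dist_of_mem (mem_range_self z.re)).trans_eq ?_
    rw [Complex.dist_of_re_eq (by simp), Complex.ofReal_im, Real.dist_eq, sub_zero]
  · refine (Metric.le_infDist (range_nonempty _)).2 ?_
    rintro _ ⟨x, rfl⟩
    simpa [dist_eq_norm] using Complex.abs_im_le_norm (z - x)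

lemma exists_norm_eq_one_infDist_lineSet {I : ℍ[ℝ]} (hI : I ∈ qSphere) (a : ℂ) {b : ℂ}
    (hb : b ≠ 0) : ∃ u : ℂ, ‖u‖ = 1 ∧ ∀ z : ℂ,
      Metric.infDist (toSlice I (a + u * z)) (lineSet (toSlice I a) (toSlice I b)) = |z.im| := by
  have hb' : ‖b‖ ≠ 0 := norm_ne_zero_iff.2 hb
  have hu : ‖b / ‖b‖‖ = 1 := by simp [hb']
  refine ⟨b / ‖b‖, hu, fun z => ?_⟩
  have hiso : Isometry fun z : ℂ => toSlice I (a + b / ‖b‖ * z) :=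
    (isometry_toSlice hI).comp <| Isometry.of_dist_eq fun z w => by
      rw [dist_add_left, dist_eq_norm, ← mul_sub, norm_mul, hu, one_mul, dist_eq_norm]
  have hline : lineSet (toSlice I a) (toSlice I b) =
      (fun z : ℂ => toSlice I (a + b / ‖b‖ * z)) '' range ((↑) : ℝ → ℂ) := by
    have key (t : ℝ) : toSlice I (a + b * t) = toSlice I a + t • toSlice I b := by
      rw [toSlice_add, toSlice_mul hI, toSlice_ofReal, Quaternion.mul_coe_eq_smul]
    ext q
    rw [← range_comp]
    constructor
    · rintro ⟨t, rfl⟩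
      refine ⟨‖b‖ * t, ?_⟩
      rw [← key]
      simp only [Function.comp_apply]
      congr 2
      push_cast
      rw [← mul_assoc, div_mul_cancel₀ b (Complex.ofReal_ne_zero.2 hb')]
    · rintro ⟨t, rfl⟩
      refine ⟨t / ‖b‖, ?_⟩
      rw [← key]
      simp only [Function.comp_apply]
      congr 2
      push_cast
      field_simp
  rw [hline, Metric.infDist_image hiso, infDist_range_ofReal]

/-- Phragmén–Lindelöf principle for strip domains. -/
theorem phragmen_lindelof_strip
    (Ω : Set ℍ[ℝ]) (hΩ : IsSliceDomain Ω)
    (p d : ℍ[ℝ] → ℍ[ℝ]) (w : ℍ[ℝ] → ℝ)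
    (hstrip : ∀ I ∈ qSphere, p I ∈ Set.range (toSlice I) ∧ d I ∈ Set.range (toSlice I) ∧
      d I ≠ 0 ∧ 0 < w I ∧
      Ω ∩ Set.range (toSlice I) =
        {q ∈ Set.range (toSlice I) | Metric.infDist q (lineSet (p I) (d I)) < w I / 2})
    (γ : ℝ) (hwidth : sSup (w '' qSphere) = γ)
    (f : ℍ[ℝ] → ℍ[ℝ]) (hf : SliceRegularOn f Ω)
    (hcont : ContinuousOn f (closure Ω))
    (N k : ℝ) (hN : 0 < N) (hk : 0 < k) (hkγ : k < Real.pi / γ)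
    (hgrowth : ∀ q ∈ Ω, ‖f q‖ ≤ N * Real.exp (Real.exp (k * ‖q‖)))
    (M : ℝ) (hM : 0 ≤ M) (hbd : ∀ q ∈ frontier Ω, ‖f q‖ ≤ M) :
    ∀ q ∈ Ω, ‖f q‖ ≤ M := by
  intro q hq
  have hw_le : ∀ I ∈ qSphere, w I ≤ γ := by
    intro I hI
    by_cases hbdd : BddAbove (w '' qSphere)
    · exact hwidth ▸ le_csSup hbdd (mem_image_of_mem w hI)
    · rw [Real.sSup_of_not_bddAbove hbdd] at hwidth
      rw [← hwidth, div_zero] at hkγ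
      exact absurd hk hkγ.not_gt
  obtain ⟨I, hI, z₀, rfl⟩ := exists_mem_range_toSlice q
  obtain ⟨⟨a, ha⟩, ⟨b, hb⟩, hd, hw, heq⟩ := hstrip I hI
  have hb₀ : b ≠ 0 := by
    rintro rfl
    exact hd (hb ▸ toSlice_zero I)
  obtain ⟨u, hu, hdist⟩ := exists_norm_eq_one_infDist_lineSet hI a hb₀
  rw [← ha, ← hb] at heq
  have hu₀ : u ≠ 0 := by
    rintro rfl
    simp at hu
  have hmem (z : ℂ) : toSlice I (a + u * z) ∈ Ω ↔ |z.im| < w I / 2 := by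
    have h := Set.ext_iff.1 heq (toSlice I (a + u * z))
    simpa [hdist] using h
  have hmaps : MapsTo (fun z : ℂ => toSlice I (a + u * z))
      (Complex.im ⁻¹' Ioo (-(w I / 2)) (w I / 2)) Ω := fun z hz => (hmem z).2 (abs_lt.2 hz)
  have hcontΦ : Continuous fun z : ℂ => toSlice I (a + u * z) :=
    (isometry_toSlice hI).continuous.comp (by fun_prop)
  have hclosure : MapsTo (fun z : ℂ => toSlice I (a + u * z))
      (closure (Complex.im ⁻¹' Ioo (-(w I / 2)) (w I / 2))) (closure Ω) := hmaps.closure hcontΦ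
  have hbdΦ (z : ℂ) (hz : |z.im| = w I / 2) : ‖f (toSlice I (a + u * z))‖ ≤ M := by
    refine hbd _ ?_
    rw [hΩ.1.frontier_eq]
    refine ⟨hclosure ?_, fun h => ((hmem z).1 h).ne hz⟩
    rw [Complex.closure_preimage_im, closure_Ioo (by linarith)]
    exact abs_le.1 hz.le
  let := sliceNormedSpace hI
  have hdiff : DiffContOnCl ℂ (fun z : ℂ => f (toSlice I (a + u * z)))
      (Complex.im ⁻¹' Ioo (-(w I / 2)) (w I / 2)) := by
    refine ⟨fun z hz => ?_, hcont.comp hcontΦ.continuousOn hclosure⟩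
    have h := hf.differentiableAt hΩ.1 hI (hmaps hz)
    exact (DifferentiableAt.comp z (f := fun z : ℂ => a + u * z) h
      (by fun_prop)).differentiableWithinAt
  obtain ⟨z, rfl⟩ : ∃ z, z₀ = a + u * z := ⟨(z₀ - a) / u, by field_simp; ring⟩
  have hz := abs_lt.1 ((hmem z).1 hq)
  refine PhragmenLindelof.horizontal_strip hdiff
    ⟨k, ?_, Real.exp (k * (‖a‖ + w I / 2)), ?_⟩ (fun z hz => hbdΦ z ?_) (fun z hz => hbdΦ z ?_)
    hz.1.le hz.2.le
  · rw [sub_neg_eq_add, add_halves]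
    exact hkγ.trans_le (div_le_div_of_nonneg_left Real.pi_pos.le hw (hw_le I hI))
  · refine Asymptotics.IsBigO.of_bound N (mem_inf_of_right fun ζ hζ => ?_)
    refine (hgrowth _ (hmaps hζ)).trans ?_
    rw [Real.norm_of_nonneg (Real.exp_nonneg _), ← Real.exp_add, ← mul_add, norm_toSlice hI]
    have him := abs_lt.2 hζ
    have h₁ : ‖a + u * ζ‖ ≤ ‖a‖ + ‖ζ‖ := by simpa [hu] using norm_add_le a (u * ζ)
    have h₂ := Complex.norm_le_abs_re_add_abs_im ζ
    gcongr
    linarith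
  · rw [hz, abs_neg, abs_of_pos (half_pos hw)]
  · rw [hz, abs_of_pos (half_pos hw)]
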